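/- M_{n×m}(K) is the direct sum of the four subspaces W_pp, W_pa, W_ap, W_aa, where W_pp consists of matrices with AĨ_m = A and Ĩ_n A = A, W_pa of those with AĨ_m = −A and Ĩ_n A = A, W_ap of those with AĨ_m = A and Ĩ_n A = −A, and W_aa of those with AĨ_m = −A and Ĩ_n A = −A; their dimensions are ⌈n/2⌉⌈m/2⌉, ⌈n/2⌉⌊m/2⌋, ⌊n/2⌋⌈m/2⌉, ⌊n/2⌋⌊m/2⌋ respectively. -/

import Mathlib

/-- The `k × k` exchange matrix, with 1's on the antidiagonal and 0's elsewhere. -/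
def exchangeMatrix (K : Type*) [Field K] (k : ℕ) : Matrix (Fin k) (Fin k) K :=
  Matrix.of fun i j => if j = i.rev then 1 else 0

theorem mul_exchangeMatrix_apply {K ι : Type*} [Field K] {m : ℕ} (A : Matrix ι (Fin m) K)
    (i : ι) (j : Fin m) : (A * exchangeMatrix K m) i j = A i j.rev := by
  have h (x : Fin m) : j = x.rev ↔ x = j.rev := by rw [eq_comm, Fin.rev_eq_iff]
  simp [Matrix.mul_apply, exchangeMatrix, h]

theorem exchangeMatrix_mul_apply {K ι : Type*} [Field K] {n : ℕ} (A : Matrix (Fin n) ι K)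
    (i : Fin n) (j : ι) : (exchangeMatrix K n * A) i j = A i.rev j := by
  simp [Matrix.mul_apply, exchangeMatrix]

/-- The matrices that are multiplied by `s` when their rows are reversed and by `t` when their
columns are reversed. -/
def reversalEigenspace (K : Type*) [Field K] (n m : ℕ) (s t : K) :
    Submodule K (Matrix (Fin n) (Fin m) K) where
  carrier := {A | ∀ i j, A i j.rev = t * A i j ∧ A i.rev j = s * A i j}
  add_mem' {A B} hA hB i j := by simp [hA i j, hB i j, mul_add]
  zero_mem' := by simp
  smul_mem' c A hA i j := by simp [hA i j, mul_left_comm]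

theorem mem_reversalEigenspace {K : Type*} [Field K] {n m : ℕ} {s t : K}
    {A : Matrix (Fin n) (Fin m) K} :
    A ∈ reversalEigenspace K n m s t ↔ ∀ i j, A i j.rev = t * A i j ∧ A i.rev j = s * A i j :=
  Iff.rfl

theorem mem_reversalEigenspace_iff_exchangeMatrix {K : Type*} [Field K] {n m : ℕ} {s t : K}
    {A : Matrix (Fin n) (Fin m) K} :
    A ∈ reversalEigenspace K n m s t ↔
      A * exchangeMatrix K m = t • A ∧ exchangeMatrix K n * A = s • A := by
  simp only [mem_reversalEigenspace, ← Matrix.ext_iff, mul_exchangeMatrix_apply,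
    exchangeMatrix_mul_apply, Matrix.smul_apply, smul_eq_mul, forall_and]

/-- `d` is the dimension of the space of vectors of length `k` that are multiplied by the sign `s`
under reversal. -/
def IsReversalDim {K : Type*} [Field K] (k : ℕ) (s : K) (d : ℕ) : Prop :=
  (s = 1 ∧ d = (k + 1) / 2) ∨ (s = -1 ∧ d = k / 2)

namespace IsReversalDim

variable {K : Type*} [Field K] {k d : ℕ} {s : K}

theorem le (h : IsReversalDim k s d) : d ≤ k := by
  rcases h with ⟨-, h⟩ | ⟨-, h⟩ <;> omega

theorem eq_zero_of_forall_castLE (h : IsReversalDim k s d) (hchar : (2 : K) ≠ 0) {v : Fin k → K}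
    (hv : ∀ i, v i.rev = s * v i) (h0 : ∀ a, v (Fin.castLE h.le a) = 0) (i : Fin k) :
    v i = 0 := by
  by_cases hi : i.val < d
  · exact h0 ⟨i, hi⟩
  by_cases hr : i.rev.val < d
  · have := hv i.rev
    rw [Fin.rev_rev] at this
    rw [this, show v i.rev = 0 from h0 ⟨i.rev, hr⟩, mul_zero]
  rw [Fin.val_rev] at hr
  have := i.isLt
  rcases h with ⟨-, h⟩ | ⟨hs, h⟩
  · omega
  · have hfix : i.rev = i := by ext; rw [Fin.val_rev]; omega
    have h2 := hv i
    rw [hfix, hs] at h2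
    have : 2 * v i = 0 := by linear_combination h2
    exact (mul_eq_zero.mp this).resolve_left hchar

/-- The matrix extending a vector of length `d` to an eigenvector of the reversal. -/
theorem exists_extension (h : IsReversalDim k s d) :
    ∃ P : Matrix (Fin k) (Fin d) K,
      (∀ i a, P i.rev a = s * P i a) ∧ P.submatrix (Fin.castLE h.le) id = 1 := by
  refine ⟨Matrix.of fun i a => if i.val = a then 1 else if i.rev.val = a then s else 0, ?_, ?_⟩
  · intro i a
    have := i.isLt
    have := a.isLt
    simp only [Matrix.of_apply, Fin.rev_rev]
    simp only [Fin.val_rev]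
    rcases h with ⟨rfl, h⟩ | ⟨rfl, h⟩ <;> split_ifs <;> first | omega | simp
  · ext a b
    have := a.isLt
    have := b.isLt
    simp only [Matrix.submatrix_apply, Matrix.of_apply, Matrix.one_apply, Fin.val_rev,
      Fin.val_castLE, id, Fin.ext_iff]
    rcases h with ⟨-, h⟩ | ⟨-, h⟩ <;> split_ifs <;> first | omega | rfl

end IsReversalDim

theorem finrank_reversalEigenspace {K : Type*} [Field K] (hchar : (2 : K) ≠ 0) {n m d e : ℕ}
    {s t : K} (hs : IsReversalDim n s d) (ht : IsReversalDim m t e) :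
    Module.finrank K (reversalEigenspace K n m s t) = d * e := by
  let corner : reversalEigenspace K n m s t →ₗ[K] Matrix (Fin d) (Fin e) K :=
    { toFun A := A.1.submatrix (Fin.castLE hs.le) (Fin.castLE ht.le)
      map_add' _ _ := rfl
      map_smul' _ _ := rfl }
  have inj : Function.Injective corner := by
    rw [← LinearMap.ker_eq_bot, LinearMap.ker_eq_bot']
    intro A hA
    ext i j
    refine hs.eq_zero_of_forall_castLE hchar (v := fun i => A.1 i j) (fun i => (A.2 i j).2) ?_ i
    intro a
    exact ht.eq_zero_of_forall_castLE hchar (fun j => (A.2 (Fin.castLE hs.le a) j).1)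
      (fun b => congrFun (congrFun hA a) b) j
  have surj : Function.Surjective corner := by
    intro B
    obtain ⟨P, hP, hP1⟩ := hs.exists_extension
    obtain ⟨Q, hQ, hQ1⟩ := ht.exists_extension
    refine ⟨⟨P * B * Q.transpose, fun i j => ⟨?_, ?_⟩⟩, ?_⟩
    · simp [Matrix.mul_apply (N := Q.transpose), hQ, Finset.mul_sum, mul_left_comm]
    · simp [Matrix.mul_apply, hP, Finset.mul_sum, Finset.sum_mul, mul_assoc]
    · change (P * B * Q.transpose).submatrix _ _ = B
      rw [Matrix.submatrix_mul _ _ _ id _ Function.bijective_id,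
        Matrix.submatrix_mul _ _ _ id _ Function.bijective_id, hP1, ← Matrix.transpose_submatrix,
        hQ1]
      simp
  rw [(LinearEquiv.ofBijective corner ⟨inj, surj⟩).finrank_eq, Module.finrank_matrix]
  simp

/-- The component of `A` in `reversalEigenspace K n m s t`, for signs `s` and `t`. -/
def reversalComponent {K : Type*} [Field K] {n m : ℕ} (s t : K) (A : Matrix (Fin n) (Fin m) K) :
    Matrix (Fin n) (Fin m) K :=
  Matrix.of fun i j =>
    (A i j + s * A i.rev j + t * A i j.rev + s * t * A i.rev j.rev) / 4

theorem reversalComponent_mem {K : Type*} [Field K] {n m : ℕ} {s t : K} (hs : s * s = 1)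
    (ht : t * t = 1) (A : Matrix (Fin n) (Fin m) K) :
    reversalComponent s t A ∈ reversalEigenspace K n m s t := by
  intro i j
  simp only [reversalComponent, Matrix.of_apply, Fin.rev_rev]
  constructor
  · linear_combination (-(A i j.rev + s * A i.rev j.rev) / 4) * ht
  · linear_combination (-(A i.rev j + t * A i.rev j.rev) / 4) * hs

theorem existsUnique_reversalEigenspace_sum {K : Type*} [Field K] (hchar : (2 : K) ≠ 0) {n m : ℕ}
    (A : Matrix (Fin n) (Fin m) K) :
    ∃! t : reversalEigenspace K n m 1 1 × reversalEigenspace K n m 1 (-1) ×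
        reversalEigenspace K n m (-1) 1 × reversalEigenspace K n m (-1) (-1),
      (t.1 : Matrix (Fin n) (Fin m) K) + t.2.1 + t.2.2.1 + t.2.2.2 = A := by
  have h4 : (4 : K) ≠ 0 := by
    rw [show (4 : K) = 2 * 2 by norm_num]
    exact mul_ne_zero hchar hchar
  refine ⟨⟨⟨reversalComponent 1 1 A, reversalComponent_mem (by ring) (by ring) A⟩,
    ⟨reversalComponent 1 (-1) A, reversalComponent_mem (by ring) (by ring) A⟩,
    ⟨reversalComponent (-1) 1 A, reversalComponent_mem (by ring) (by ring) A⟩,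
    ⟨reversalComponent (-1) (-1) A, reversalComponent_mem (by ring) (by ring) A⟩⟩, ?_, ?_⟩
  · ext i j
    simp only [reversalComponent, Matrix.add_apply, Matrix.of_apply]
    field_simp
    ring
  · rintro ⟨⟨B, hB⟩, ⟨C, hC⟩, ⟨D, hD⟩, ⟨E, hE⟩⟩ rfl
    simp only [Prod.mk.injEq, Subtype.mk.injEq]
    refine ⟨?_, ?_, ?_, ?_⟩ <;> ext i j <;>
      simp only [reversalComponent, Matrix.add_apply, Matrix.of_apply, (hB _ _).1, (hB _ _).2,
        (hC _ _).1, (hC _ _).2, (hD _ _).1, (hD _ _).2, (hE _ _).1, (hE _ _).2] <;>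
      field_simp <;> ring

theorem four_subspaces_direct_sum {K : Type*} [Field K] (hchar : (2 : K) ≠ 0)
    (n m : ℕ) :
    ∃ Wpp Wpa Wap Waa : Submodule K (Matrix (Fin n) (Fin m) K),
      (Wpp : Set (Matrix (Fin n) (Fin m) K))
          = {A : Matrix (Fin n) (Fin m) K | A * exchangeMatrix K m = A ∧ exchangeMatrix K n * A = A} ∧
      (Wpa : Set (Matrix (Fin n) (Fin m) K))
          = {A : Matrix (Fin n) (Fin m) K | A * exchangeMatrix K m = -A ∧ exchangeMatrix K n * A = A} ∧
      (Wap : Set (Matrix (Fin n) (Fin m) K))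
          = {A : Matrix (Fin n) (Fin m) K | A * exchangeMatrix K m = A ∧ exchangeMatrix K n * A = -A} ∧
      (Waa : Set (Matrix (Fin n) (Fin m) K))
          = {A : Matrix (Fin n) (Fin m) K | A * exchangeMatrix K m = -A ∧ exchangeMatrix K n * A = -A} ∧
      (∀ A : Matrix (Fin n) (Fin m) K,
        ∃! t : Wpp × Wpa × Wap × Waa,
          (t.1 : Matrix (Fin n) (Fin m) K) + t.2.1 + t.2.2.1 + t.2.2.2 = A) ∧
      Module.finrank K Wpp = ((n + 1) / 2) * ((m + 1) / 2) ∧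
      Module.finrank K Wpa = ((n + 1) / 2) * (m / 2) ∧
      Module.finrank K Wap = (n / 2) * ((m + 1) / 2) ∧
      Module.finrank K Waa = (n / 2) * (m / 2) := by 
  refine ⟨reversalEigenspace K n m 1 1, reversalEigenspace K n m 1 (-1),
    reversalEigenspace K n m (-1) 1, reversalEigenspace K n m (-1) (-1), ?_, ?_, ?_, ?_,
    existsUnique_reversalEigenspace_sum hchar,
    finrank_reversalEigenspace hchar (.inl ⟨rfl, rfl⟩) (.inl ⟨rfl, rfl⟩),
    finrank_reversalEigenspace hchar (.inl ⟨rfl, rfl⟩) (.inr ⟨rfl, rfl⟩),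
    finrank_reversalEigenspace hchar (.inr ⟨rfl, rfl⟩) (.inl ⟨rfl, rfl⟩),
    finrank_reversalEigenspace hchar (.inr ⟨rfl, rfl⟩) (.inr ⟨rfl, rfl⟩)⟩ <;>
  · ext A
    simp [mem_reversalEigenspace_iff_exchangeMatrix]
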